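/- arXiv:2307.08400 — 5 statements merged into one kernel-verified Lean document; each statement's English description precedes it below -/
import Mathlib

section
/- Let G be a group generated by a finite set S. Suppose g ∈ G is an element of infinite order such that ⟨g⟩ ∩ Z(G) is finite, where Z(G) is the center of G. Then there exists a ∈ S such that [gᵏ, a] ≠ 1 for every integer k ≥ 1, and [gᵏ, a] ≠ [gʲ, a] for any two distinct integers k ≠ j ≥ 1. In particular, the set of commutators {[x, y] : x, y ∈ G} is infinite. -/
open scoped commutatorElement

theorem Subgroup.mem_center_of_closure_eq_top {G : Type*} [Group G] {S : Set G}
    (hS : Subgroup.closure S = ⊤) {z : G} (hz : ∀ a ∈ S, Commute z a) :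
    z ∈ Subgroup.center G := by
  have hle : Subgroup.closure S ≤ Subgroup.centralizer {z} :=
    (Subgroup.closure_le _).2 fun a ha => Subgroup.mem_centralizer_singleton_iff.2 (hz a ha).symm.eq
  rw [hS] at hle
  exact Subgroup.mem_center_iff.2 fun x =>
    Subgroup.mem_centralizer_singleton_iff.1 (hle (Subgroup.mem_top x))

theorem pow_notMem_center_of_finite_inter {G : Type*} [Group G] {g : G} (hg : ¬ IsOfFinOrder g)
    (hZ : ((Subgroup.zpowers g : Set G) ∩ (Subgroup.center G : Set G)).Finite) {n : ℕ}
    (hn : n ≠ 0) : g ^ n ∉ Subgroup.center G := by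
  intro hc
  have hinj : Function.Injective fun m : ℕ => (g ^ n) ^ m :=
    injective_pow_iff_not_isOfFinOrder.2 fun h => hg (h.of_pow hn)
  refine (Set.infinite_of_injective_forall_mem hinj fun m => ?_) hZ
  constructor
  · exact Subgroup.pow_mem _ (Subgroup.pow_mem _ (Subgroup.mem_zpowers g) n) m
  · exact Subgroup.pow_mem _ hc m

theorem exists_mem_forall_not_commute_pow {G : Type*} [Group G] {S : Finset G}
    (hgen : Subgroup.closure (S : Set G) = ⊤) {g : G}
    (hcenter : ∀ n : ℕ, n ≠ 0 → g ^ n ∉ Subgroup.center G) :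
    ∃ a ∈ S, ∀ n : ℕ, n ≠ 0 → ¬ Commute (g ^ n) a := by
  by_contra! h
  choose! n hn hcomm using h
  refine hcenter (∏ a ∈ S, n a) (Finset.prod_ne_zero_iff.2 hn)
    (Subgroup.mem_center_of_closure_eq_top hgen fun a ha => ?_)
  obtain ⟨m, hm⟩ := Finset.dvd_prod_of_mem n ha
  rw [hm, pow_mul]
  exact (hcomm a ha).pow_left m

theorem commute_inv_mul_of_commutatorElement_eq {G : Type*} [Group G] {x y a : G}
    (h : ⁅x, a⁆ = ⁅y, a⁆) : Commute (y⁻¹ * x) a := by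
  rw [commutatorElement_def, commutatorElement_def, mul_left_inj] at h
  calc y⁻¹ * x * a = y⁻¹ * (x * a * x⁻¹) * x := by group
    _ = a * (y⁻¹ * x) := by rw [h]; group

/-- Let `G` be a group generated by a finite set `S` and let `g ∈ G` have
infinite order with `⟨g⟩ ∩ Z(G)` finite. Then there is `a ∈ S` with `[gᵏ, a] ≠ 1` for all
`k ≥ 1` and `[gᵏ, a] ≠ [gʲ, a]` for distinct `k, j ≥ 1`; in particular the set of
commutators of `G` is infinite. -/
theorem statement8 {G : Type*} [Group G] (S : Finset G)
    (hgen : Subgroup.closure (S : Set G) = ⊤) (g : G) (hg : ¬ IsOfFinOrder g)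
    (hZ : ((Subgroup.zpowers g : Set G) ∩ (Subgroup.center G : Set G)).Finite) :
    (∃ a ∈ S, (∀ k : ℕ, 1 ≤ k → ⁅g ^ k, a⁆ ≠ 1) ∧
        ∀ k j : ℕ, 1 ≤ k → 1 ≤ j → k ≠ j → ⁅g ^ k, a⁆ ≠ ⁅g ^ j, a⁆) ∧
      {z : G | ∃ x y : G, z = ⁅x, y⁆}.Infinite := by
  obtain ⟨a, ha, hcomm⟩ := exists_mem_forall_not_commute_pow hgen fun _ =>
    pow_notMem_center_of_finite_inter hg hZ
  have hinj : Function.Injective fun k : ℕ => ⁅g ^ k, a⁆ := by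
    refine Function.Injective.of_lt_imp_ne fun j k hjk h => hcomm (k - j) (by omega) ?_
    have := commute_inv_mul_of_commutatorElement_eq h.symm
    rwa [← pow_mul_pow_sub g hjk.le, inv_mul_cancel_left] at this
  refine ⟨⟨a, ha, fun k hk h => ?_, fun k j _ _ hkj => hinj.ne hkj⟩, ?_⟩
  · exact hcomm k (by omega) (commutatorElement_eq_one_iff_commute.1 h)
  · exact Set.infinite_of_injective_forall_mem hinj fun k => ⟨g ^ k, a, rfl⟩
end

section
/- Let G be a finitely generated group that is not virtually abelian. Then there exists a constant c ∈ (0, 1), depending only on G and not on the generating set, such that for every finite generating set S of G and every n ∈ ℕ with n ≥ 1, the set of commutators C(S^{≤n}, S^{≤n}) = {[g, h] : g, h ∈ S^{≤n}} has cardinality at least c·n. -/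
open Pointwise
open scoped commutatorElement

/-- `S^{≤n}`: the set of elements expressible as a product of at most `n` elements
of `S ∪ S⁻¹`. -/
def ballSet {G : Type*} [Group G] (S : Set G) (n : ℕ) : Set G :=
  (insert (1 : G) (S ∪ S⁻¹)) ^ n

/-- The set of commutators `C(A, B) = {[g, h] : g ∈ A, h ∈ B}`. -/
def commPairs {G : Type*} [Group G] (A B : Set G) : Set G :=
  {z : G | ∃ g ∈ A, ∃ h ∈ B, z = ⁅g, h⁆}

/-- A group is virtually abelian if it contains an abelian subgroup of finite index. -/
def VirtuallyAbelian (G : Type*) [Group G] : Prop :=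
  ∃ A : Subgroup G, A.FiniteIndex ∧ ∀ x ∈ A, ∀ y ∈ A, x * y = y * x

/-- Powers of a finite set in a monoid are finite. -/
theorem finite_set_pow {M : Type*} [Monoid M] {B : Set M} (hB : B.Finite) (n : ℕ) :
    (B ^ n).Finite := by
  induction n with
  | zero => simp
  | succ n ih => rw [pow_succ]; exact ih.mul hB

/-- If `x` has infinitely many conjugates, then its conjugates by the `n`-th power of a finite
symmetric generating set containing `1` number more than `n`. -/
theorem lt_ncard_conj_image_pow {G : Type*} [Group G] {B : Set G}
    (hfin : B.Finite) (hone : 1 ∈ B) (hinv : B⁻¹ ⊆ B) (hgen : Subgroup.closure B = ⊤) {x : G}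
    (hx : (conjugatesOf x).Infinite) (n : ℕ) :
    n < ((fun g : G => g * x * g⁻¹) '' (B ^ n)).ncard := by
  have hpow : ∀ n : ℕ, (B ^ n).Finite := finite_set_pow hfin
  induction n with
  | zero => simp
  | succ n ih =>
    have hsub : (fun g : G => g * x * g⁻¹) '' (B ^ n) ⊆
        (fun g : G => g * x * g⁻¹) '' (B ^ (n + 1)) :=
      Set.image_mono (Set.pow_subset_pow_right hone n.le_succ)
    refine lt_of_le_of_lt (Nat.succ_le_of_lt ih)
      (Set.ncard_lt_ncard (hsub.ssubset_of_ne fun heq => hx ?_) ((hpow _).image _))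
    have hstep : ∀ b ∈ B, ∀ y ∈ (fun g : G => g * x * g⁻¹) '' (B ^ n),
        b * y * b⁻¹ ∈ (fun g : G => g * x * g⁻¹) '' (B ^ n) := by
      rintro b hb _ ⟨g, hg, rfl⟩
      rw [heq]
      exact ⟨b * g, by rw [pow_succ']; exact Set.mul_mem_mul hb hg, by group⟩
    refine ((hpow n).image fun g : G => g * x * g⁻¹).subset fun y hy => ?_
    obtain ⟨g, rfl⟩ := isConj_iff.mp hy
    clear hy
    have hg : g ∈ Subgroup.closure B := hgen ▸ Subgroup.mem_top g
    induction hg using Subgroup.closure_induction_left with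
    | one => exact ⟨1, Set.one_mem_pow hone, rfl⟩
    | mul_left b hb g _ ihg => simpa only [mul_inv_rev, mul_assoc] using hstep b hb _ ihg
    | inv_mul_cancel b hb g _ ihg =>
      simpa only [mul_inv_rev, mul_assoc] using hstep b⁻¹ (hinv (Set.inv_mem_inv.mpr hb)) _ ihg

/-- The centralizer of an element with finitely many conjugates has finite index. -/
theorem finiteIndex_centralizer_of_finite_conjugatesOf {G : Type*} [Group G] {x : G}
    (hx : (conjugatesOf x).Finite) : (Subgroup.centralizer {x}).FiniteIndex := by
  have := hx.to_subtype
  let f : G ⧸ Subgroup.centralizer {x} → conjugatesOf x := fun q =>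
    ⟨q.out * x * q.out⁻¹, isConj_iff.mpr ⟨q.out, rfl⟩⟩
  have hf : Function.Injective f := fun p q hpq => by
    have h : p.out * x * p.out⁻¹ = q.out * x * q.out⁻¹ := congrArg Subtype.val hpq
    rw [← p.out_eq', ← q.out_eq', QuotientGroup.eq, Subgroup.mem_centralizer_singleton_iff]
    calc p.out⁻¹ * q.out * x = p.out⁻¹ * (q.out * x * q.out⁻¹) * q.out := by group
      _ = x * (p.out⁻¹ * q.out) := by rw [← h]; group
  have := Finite.of_injective f hf
  exact Subgroup.finiteIndex_of_finite_quotient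

/-- A group generated by finitely many elements, each having finitely many conjugates, is
virtually abelian. -/
theorem virtuallyAbelian_of_finite_conjugatesOf {G : Type*} [Group G] (S : Finset G)
    (hgen : Subgroup.closure (S : Set G) = ⊤) (hS : ∀ s ∈ S, (conjugatesOf s).Finite) :
    VirtuallyAbelian G := by
  refine ⟨Subgroup.center G, ?_, fun x hx y _ => (Subgroup.mem_center_iff.mp hx y).symm⟩
  rw [Subgroup.center_eq_infi' hgen]
  exact Subgroup.finiteIndex_iInf fun s => finiteIndex_centralizer_of_finite_conjugatesOf (hS s s.2)

/-- Let `G` be a finitely generated group that is not virtually abelian.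
Then there is `c ∈ (0,1)`, depending only on `G`, such that for every finite generating
set `S` of `G` and every `n ≥ 1`, `|C(S^{≤n}, S^{≤n})| ≥ c·n`. -/
theorem statement10 {G : Type*} [Group G] (hfg : Group.FG G)
    (hva : ¬ VirtuallyAbelian G) :
    ∃ c : ℝ, 0 < c ∧ c < 1 ∧
      ∀ S : Finset G, Subgroup.closure (S : Set G) = ⊤ →
        ∀ n : ℕ, 1 ≤ n →
          c * n ≤ ((commPairs (ballSet (S : Set G) n) (ballSet (S : Set G) n)).ncard : ℝ) := by
  refine ⟨1 / 2, by norm_num, by norm_num, fun S hS n hn => ?_⟩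
  obtain ⟨s, hs, hinf⟩ : ∃ s ∈ S, (conjugatesOf s).Infinite := by
    by_contra h
    exact hva (virtuallyAbelian_of_finite_conjugatesOf S hS
      fun s hs => Set.not_infinite.mp fun hinf => h ⟨s, hs, hinf⟩)
  have hBfin : (insert (1 : G) ((S : Set G) ∪ (S : Set G)⁻¹)).Finite :=
    (S.finite_toSet.union S.finite_toSet.inv).insert 1
  have hsub : (S : Set G) ⊆ insert (1 : G) ((S : Set G) ∪ (S : Set G)⁻¹) :=
    Set.subset_union_left.trans (Set.subset_insert _ _)
  have hball : (ballSet (S : Set G) n).Finite := finite_set_pow hBfin n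
  have hsball : s ∈ ballSet (S : Set G) n :=
    Set.pow_subset_pow_right (Set.mem_insert _ _) hn (by simpa using hsub hs)
  have hcount : n < ((fun g : G => g * s * g⁻¹) '' ballSet (S : Set G) n).ncard :=
    lt_ncard_conj_image_pow hBfin (Set.mem_insert _ _)
      (by simp [Set.inv_insert, Set.union_comm])
      (top_le_iff.mp (hS ▸ Subgroup.closure_mono hsub)) hinf n
  have hcomm : (commPairs (ballSet (S : Set G) n) (ballSet (S : Set G) n)).Finite :=
    (hball.image2 (fun g h => ⁅g, h⁆) hball).subset
      fun _ ⟨g, hg, h, hh, hz⟩ => ⟨g, hg, h, hh, hz.symm⟩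
  have hle : ((fun g : G => g * s * g⁻¹) '' ballSet (S : Set G) n).ncard ≤
      (commPairs (ballSet (S : Set G) n) (ballSet (S : Set G) n)).ncard := by
    refine Set.ncard_le_ncard_of_injOn (fun z => z * s⁻¹) ?_
      (fun a _ b _ hab => mul_right_cancel hab) hcomm
    rintro _ ⟨g, hg, rfl⟩
    exact ⟨g, hg, s, hsball, (commutatorElement_def g s).symm⟩
  have hnle : (n : ℝ) ≤ (commPairs (ballSet (S : Set G) n) (ballSet (S : Set G) n)).ncard :=
    mod_cast (hcount.trans_le hle).le
  have hn0 : (0 : ℝ) ≤ n := n.cast_nonneg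
  linarith
end

section
/- Let G be a finitely generated group such that the set of all commutators {[g, h] : g, h ∈ G} is finite. Then G is virtually abelian. -/
open Pointwise
open scoped commutatorElement

/-- A finitely generated group whose set of commutators is finite is
virtually abelian. -/
theorem statement11 {G : Type*} [Group G] (hfg : Group.FG G)
    (h : {z : G | ∃ x y : G, z = ⁅x, y⁆}.Finite) :
    VirtuallyAbelian G := by
  have hset : commutatorSet G = {z : G | ∃ x y : G, z = ⁅x, y⁆} := by
    ext z
    simp [commutatorSet, eq_comm]
  have : Finite (commutatorSet G) := by
    rw [hset]
    exact h.to_subtype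
  exact ⟨Subgroup.center G, inferInstance,
    fun x hx y _ => (Subgroup.mem_center_iff.mp hx y).symm⟩
end

section
/- Let G be a finitely generated group that is nilpotent of class at most 2 (i.e. [G, [G, G]] = 1) and not virtually abelian, with finite generating set S. Then for every n ∈ ℕ with n ≥ 1, the set of commutators C(S^{≤n}, S^{≤n}) = {[g, h] : g, h ∈ S^{≤n}} has cardinality at least n. -/
open Pointwise
open scoped commutatorElement

section ClassTwo

variable {G : Type*} [Group G]

theorem commutatorElement_mem_center_of_commutator_eq_bot
    (hnil : ⁅(⊤ : Subgroup G), ⁅(⊤ : Subgroup G), (⊤ : Subgroup G)⁆⁆ = ⊥) (g h : G) :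
    ⁅g, h⁆ ∈ Subgroup.center G := by
  rw [Subgroup.mem_center_iff]
  intro x
  have hx : ⁅x, ⁅g, h⁆⁆ ∈ ⁅(⊤ : Subgroup G), ⁅(⊤ : Subgroup G), (⊤ : Subgroup G)⁆⁆ :=
    Subgroup.commutator_mem_commutator trivial
      (Subgroup.commutator_mem_commutator trivial trivial)
  rw [hnil, Subgroup.mem_bot] at hx
  exact commutatorElement_eq_one_iff_mul_comm.mp hx

theorem commutatorElement_pow_left_of_mem_center
    (hc : ∀ g h : G, ⁅g, h⁆ ∈ Subgroup.center G) (g h : G) (n : ℕ) :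
    ⁅g ^ n, h⁆ = ⁅g, h⁆ ^ n := by
  induction n with
  | zero => simp
  | succ n ih =>
    have hcomm := Subgroup.mem_center_iff.mp (hc g h) (g ^ n)
    calc ⁅g ^ (n + 1), h⁆ = g ^ n * ⁅g, h⁆ * (h * (g ^ n)⁻¹ * h⁻¹) := by
          simp only [commutatorElement_def, pow_succ]; group
      _ = ⁅g, h⁆ * ⁅g ^ n, h⁆ := by
          rw [hcomm]; simp only [commutatorElement_def]; group
      _ = ⁅g, h⁆ ^ (n + 1) := by rw [ih, pow_succ']

/-- If all commutators of a finite generating set have finite order, then the centre of a group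
of class at most two has finite index. -/
theorem finiteIndex_center_of_isOfFinOrder_commutatorElement
    (hc : ∀ g h : G, ⁅g, h⁆ ∈ Subgroup.center G) (S : Finset G)
    (hgen : Subgroup.closure (S : Set G) = ⊤)
    (hfin : ∀ s ∈ S, ∀ t ∈ S, IsOfFinOrder ⁅s, t⁆) :
    (Subgroup.center G).FiniteIndex := by
  have hpow (s : G) (hs : s ∈ S) : ∃ m : ℕ, 0 < m ∧ s ^ m ∈ Subgroup.center G := by
    refine ⟨∏ t ∈ S, orderOf ⁅s, t⁆, Finset.prod_pos fun t ht => (hfin s hs t ht).orderOf_pos, ?_⟩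
    rw [← Subgroup.centralizer_univ, ← Subgroup.coe_top, ← hgen, Subgroup.centralizer_closure,
      Subgroup.mem_centralizer_iff_commutator_eq_one']
    intro t ht
    rw [commutatorElement_pow_left_of_mem_center hc, ← orderOf_dvd_iff_pow_eq_one]
    exact Finset.dvd_prod_of_mem _ ht
  let _ : CommGroup (G ⧸ Subgroup.center G) :=
    { (inferInstance : Group (G ⧸ Subgroup.center G)) with
      mul_comm := by
        rintro ⟨a⟩ ⟨b⟩
        refine commutatorElement_eq_one_iff_mul_comm.mp ?_
        exact (QuotientGroup.eq_one_iff ⁅a, b⁆).mpr (hc a b) }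
  have hfg : Group.FG G := ⟨⟨S, hgen⟩⟩
  have htors (g : G) : IsOfFinOrder (g : G ⧸ Subgroup.center G) := by
    have hg : g ∈ Subgroup.closure (S : Set G) := hgen ▸ Subgroup.mem_top g
    induction hg using Subgroup.closure_induction with
    | mem s hs =>
      obtain ⟨m, hm, hsm⟩ := hpow s hs
      exact isOfFinOrder_iff_pow_eq_one.mpr ⟨m, hm, (QuotientGroup.eq_one_iff (s ^ m)).mpr hsm⟩
    | one => exact IsOfFinOrder.one
    | mul a b _ _ ha hb => exact ha.mul hb
    | inv a _ ha => exact ha.inv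
  have : Finite (G ⧸ Subgroup.center G) :=
    CommGroup.finite_of_fg_isMulTorsion _ (by rintro ⟨g⟩; exact htors g)
  exact Subgroup.finiteIndex_of_finite_quotient

end ClassTwo

theorem finite_ballSet {G : Type*} [Group G] {S : Set G} (hS : S.Finite) (n : ℕ) :
    (ballSet S n).Finite := by
  have hA : (insert (1 : G) (S ∪ S⁻¹)).Finite := (hS.union hS.inv).insert 1
  induction n with
  | zero => simp [ballSet]
  | succ n ih =>
    rw [ballSet, pow_succ]
    exact ih.mul hA

theorem pow_mem_ballSet {G : Type*} [Group G] {S : Set G} {s : G} (hs : s ∈ S) {i n : ℕ}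
    (hin : i ≤ n) : s ^ i ∈ ballSet S n :=
  Set.pow_subset_pow_right (Set.mem_insert _ _) hin
    (Set.pow_mem_pow (Set.mem_insert_of_mem _ (Or.inl hs)))

theorem finite_commPairs {G : Type*} [Group G] {A B : Set G} (hA : A.Finite) (hB : B.Finite) :
    (commPairs A B).Finite := by
  refine (hA.image2 (fun g h => ⁅g, h⁆) hB).subset ?_
  rintro z ⟨g, hg, h, hh, rfl⟩
  exact ⟨g, hg, h, hh, rfl⟩

/-- Let `G` be a finitely generated group of nilpotency class at most 2
(`[G,[G,G]] = 1`) that is not virtually abelian, with finite generating set `S`. Then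
`|C(S^{≤n}, S^{≤n})| ≥ n` for every `n ≥ 1`. -/
theorem statement17 {G : Type*} [Group G]
    (hnil : ⁅(⊤ : Subgroup G), ⁅(⊤ : Subgroup G), (⊤ : Subgroup G)⁆⁆ = ⊥)
    (hva : ¬ VirtuallyAbelian G)
    (S : Finset G) (hgen : Subgroup.closure (S : Set G) = ⊤) :
    ∀ n : ℕ, 1 ≤ n →
      n ≤ (commPairs (ballSet (S : Set G) n) (ballSet (S : Set G) n)).ncard := by
  have hc := commutatorElement_mem_center_of_commutator_eq_bot hnil
  obtain ⟨s, hs, t, ht, hst⟩ : ∃ s ∈ S, ∃ t ∈ S, ¬ IsOfFinOrder ⁅s, t⁆ := by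
    by_contra! hfin
    exact hva ⟨Subgroup.center G,
      finiteIndex_center_of_isOfFinOrder_commutatorElement hc S hgen hfin,
      fun x _ y hy => Subgroup.mem_center_iff.mp hy x⟩
  intro n hn
  have hinj : Function.Injective fun i : ℕ => ⁅s, t⁆ ^ i :=
    injective_pow_iff_not_isOfFinOrder.mpr hst
  have hball := finite_ballSet S.finite_toSet n
  calc n = ((fun i : ℕ => ⁅s, t⁆ ^ i) '' (Finset.range n : Set ℕ)).ncard := by
        rw [Set.ncard_image_of_injective _ hinj, Set.ncard_coe_finset, Finset.card_range]
    _ ≤ _ := by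
        refine Set.ncard_le_ncard ?_ (finite_commPairs hball hball)
        rintro _ ⟨i, hi, rfl⟩
        have hin : i ≤ n := (Finset.mem_range.mp hi).le
        exact ⟨s ^ i, pow_mem_ballSet hs hin, t, by simpa using pow_mem_ballSet ht hn,
          (commutatorElement_pow_left_of_mem_center hc s t i).symm⟩
end

section
/- Let G be a finitely generated group that is not virtually abelian, with finite generating set S, and suppose G has a subgroup of finite index d that is nilpotent of class at most 2. Then for every n ∈ ℕ with n ≥ 1, the set of commutators C(S^{≤n}, S^{≤n}) = {[g, h] : g, h ∈ S^{≤n}} has cardinality at least n/(3d). -/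
open Pointwise
open scoped commutatorElement

/-- In a commutative group, a finite set of elements of finite order generates a finite
subgroup. -/
theorem finite_closure_of_isOfFinOrder {A : Type*} [CommGroup A] {X : Set A} (hX : X.Finite)
    (hfin : ∀ x ∈ X, IsOfFinOrder x) : Finite (Subgroup.closure X) := by
  have hle : Subgroup.closure X ≤ CommGroup.torsion A := by
    rw [Subgroup.closure_le]
    exact hfin
  have : Finite X := hX
  exact CommGroup.finite_of_fg_isMulTorsion _ fun x => Submonoid.isOfFinOrder_coe.mp (hle x.2)

open scoped IsMulCommutative in
/-- If a group of nilpotency class at most two is generated by a finite set whose pairwise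
commutators have finite order, then it has only finitely many commutators. -/
theorem finite_commutatorSet_of_isOfFinOrder {K : Type*} [Group K]
    (hK : ∀ x y : K, ⁅x, y⁆ ∈ Subgroup.center K) {T : Set K} (hT : T.Finite)
    (hgen : Subgroup.closure T = ⊤) (hfin : ∀ s ∈ T, ∀ t ∈ T, IsOfFinOrder ⁅s, t⁆) :
    (commutatorSet K).Finite := by
  let c : K → K → Subgroup.center K := fun x y => ⟨⁅x, y⁆, hK x y⟩
  have hleft : ∀ x y z, c (x * y) z = c x z * c y z := fun x y z => Subtype.ext <| by
    have h := Subgroup.mem_center_iff.mp (hK y z) x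
    change ⁅x * y, z⁆ = ⁅x, z⁆ * ⁅y, z⁆
    calc ⁅x * y, z⁆ = x * ⁅y, z⁆ * (z * x⁻¹ * z⁻¹) := by simp only [commutatorElement_def]; group
      _ = ⁅y, z⁆ * ⁅x, z⁆ := by rw [h]; simp only [commutatorElement_def]; group
      _ = ⁅x, z⁆ * ⁅y, z⁆ := (Subgroup.mem_center_iff.mp (hK y z) _).symm
  have hswap : ∀ x y, c x y = (c y x)⁻¹ := fun x y => Subtype.ext (commutatorElement_inv y x).symm
  have hright : ∀ x y z, c x (y * z) = c x y * c x z := fun x y z => by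
    rw [hswap, hleft, mul_inv, ← hswap, ← hswap]
  let X : Set (Subgroup.center K) := Set.image2 c T T
  have hXfin : Finite (Subgroup.closure X) := by
    refine finite_closure_of_isOfFinOrder (hT.image2 c hT) ?_
    rintro _ ⟨s, hs, t, ht, rfl⟩
    exact Submonoid.isOfFinOrder_coe.mp (hfin s hs t ht)
  have hone : ∀ x, c 1 x = 1 := fun x => Subtype.ext (commutatorElement_one_left x)
  have hone' : ∀ x, c x 1 = 1 := fun x => Subtype.ext (commutatorElement_one_right x)
  have hinv : ∀ x y, c x⁻¹ y = (c x y)⁻¹ := fun x y =>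
    eq_inv_of_mul_eq_one_left (by rw [← hleft, inv_mul_cancel, hone])
  have hinv' : ∀ x y, c x y⁻¹ = (c x y)⁻¹ := fun x y =>
    eq_inv_of_mul_eq_one_left (by rw [← hright, inv_mul_cancel, hone'])
  have hmem : ∀ x y, c x y ∈ Subgroup.closure X := by
    intro x y
    have hx : x ∈ Subgroup.closure T := hgen ▸ Subgroup.mem_top x
    have hy : y ∈ Subgroup.closure T := hgen ▸ Subgroup.mem_top y
    induction hx, hy using Subgroup.closure_induction₂ with
    | mem x y hx hy => exact Subgroup.subset_closure ⟨x, hx, y, hy, rfl⟩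
    | one_left x hx => exact hone x ▸ one_mem _
    | one_right x hx => exact hone' x ▸ one_mem _
    | mul_left x y z _ _ _ h₁ h₂ => exact hleft x y z ▸ mul_mem h₁ h₂
    | mul_right x y z _ _ _ h₁ h₂ => exact hright _ _ _ ▸ mul_mem h₁ h₂
    | inv_left x y _ _ h => exact hinv x y ▸ inv_mem h
    | inv_right x y _ _ h => exact hinv' x y ▸ inv_mem h
  have hfinX : (Subgroup.closure X : Set (Subgroup.center K)).Finite := hXfin
  refine (hfinX.image Subtype.val).subset ?_
  rintro _ ⟨x, y, rfl⟩
  exact ⟨c x y, hmem x y, rfl⟩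

/-- A group with a finite-index, finitely generated subgroup having finitely many commutators
is virtually abelian. -/
theorem virtuallyAbelian_of_finite_commutatorSet {G : Type*} [Group G] (H : Subgroup G)
    [H.FiniteIndex] [Group.FG H] (hH : (commutatorSet H).Finite) : VirtuallyAbelian G := by
  have : Finite (commutatorSet H) := hH
  refine ⟨(Subgroup.center H).map H.subtype, ⟨?_⟩, ?_⟩
  · rw [Subgroup.index_map_subtype]
    exact mul_ne_zero Subgroup.FiniteIndex.index_ne_zero Subgroup.FiniteIndex.index_ne_zero
  · rintro _ ⟨x, hx, rfl⟩ _ ⟨y, hy, rfl⟩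
    rw [← map_mul, ← map_mul, Subgroup.mem_center_iff.mp hy x]

section Ball

variable {G : Type*} [Group G] {S : Set G} {m n : ℕ} {g h : G}

theorem ballSet_finite (hS : S.Finite) (n : ℕ) : (ballSet S n).Finite := by
  have hfin : (insert (1 : G) (S ∪ S⁻¹)).Finite := (hS.union hS.inv).insert 1
  induction n with
  | zero => simp [ballSet]
  | succ n ih =>
    rw [ballSet, pow_succ]
    exact ih.mul hfin

theorem ballSet_mono (hmn : m ≤ n) : ballSet S m ⊆ ballSet S n :=
  Set.pow_subset_pow_right (Set.mem_insert _ _) hmn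

theorem one_mem_ballSet (S : Set G) (n : ℕ) : (1 : G) ∈ ballSet S n :=
  Set.one_mem_pow (Set.mem_insert _ _)

theorem subset_ballSet_one : S ⊆ ballSet S 1 := fun x hx => by
  simp [ballSet, hx]

theorem mul_mem_ballSet (hg : g ∈ ballSet S m) (hh : h ∈ ballSet S n) :
    g * h ∈ ballSet S (m + n) := by
  rw [ballSet, pow_add]
  exact Set.mul_mem_mul hg hh

theorem inv_mem_ballSet (hg : g ∈ ballSet S n) : g⁻¹ ∈ ballSet S n := by
  have hsymm : (insert (1 : G) (S ∪ S⁻¹))⁻¹ = insert (1 : G) (S ∪ S⁻¹) := by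
    simp [Set.inv_insert, Set.union_comm]
  rw [ballSet, ← Set.mem_inv, ← inv_pow, hsymm]
  exact hg

theorem pow_mem_ballSet_s18 (hg : g ∈ ballSet S m) (k : ℕ) : g ^ k ∈ ballSet S (m * k) := by
  rw [ballSet, pow_mul]
  exact Set.pow_mem_pow hg

theorem commPairs_finite {A B : Set G} (hA : A.Finite) (hB : B.Finite) :
    (commPairs A B).Finite := by
  refine (Set.Finite.image2 (fun g h => ⁅g, h⁆) hA hB).subset ?_
  rintro _ ⟨g, hg, h, hh, rfl⟩
  exact ⟨g, hg, h, hh, rfl⟩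

/-- The left cosets of `H` meeting the ball of radius `n` are either all cosets or at least
`n + 1` in number. -/
theorem image_mk_ballSet_eq_univ_or (hS : Subgroup.closure S = ⊤) (H : Subgroup G)
    [H.FiniteIndex] (n : ℕ) :
    (QuotientGroup.mk '' ballSet S n : Set (G ⧸ H)) = Set.univ ∨
      n + 1 ≤ (QuotientGroup.mk '' ballSet S n : Set (G ⧸ H)).ncard := by
  induction n with
  | zero => right; simp [ballSet]
  | succ n ih =>
    set A : Set (G ⧸ H) := QuotientGroup.mk '' ballSet S n
    set A' : Set (G ⧸ H) := QuotientGroup.mk '' ballSet S (n + 1)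
    have hsub : A ⊆ A' := Set.image_mono (ballSet_mono n.le_succ)
    by_cases heq : A = A'
    · left
      have hstep : ∀ s ∈ insert (1 : G) (S ∪ S⁻¹), ∀ a ∈ A, s • a ∈ A := by
        rintro s hs _ ⟨b, hb, rfl⟩
        rw [heq]
        exact ⟨s * b, add_comm 1 n ▸ mul_mem_ballSet (m := 1) (by simpa [ballSet] using hs) hb, rfl⟩
      have hall : ∀ g : G, ∀ a ∈ A, g • a ∈ A := by
        intro g
        have hg : g ∈ Subgroup.closure S := hS ▸ Subgroup.mem_top g
        induction hg using Subgroup.closure_induction'' with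
        | one => intro a ha; rwa [one_smul]
        | mem x hx => exact hstep x (by simp [hx])
        | inv_mem x hx => exact hstep x⁻¹ (by simp [hx])
        | mul x y _ _ hx hy => intro a ha; rw [mul_smul]; exact hx _ (hy _ ha)
      rw [← heq, Set.eq_univ_iff_forall]
      intro q
      induction q using QuotientGroup.induction_on with
      | H g => simpa using hall g _ ⟨1, one_mem_ballSet S n, rfl⟩
    · rcases ih with h | h
      · left
        exact Set.univ_subset_iff.mp (h ▸ hsub)
      · right
        exact Nat.succ_le_of_lt
          (h.trans_lt (Set.ncard_lt_ncard (hsub.ssubset_of_ne heq) (Set.toFinite _)))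

/-- Every element is, up to left multiplication by `H`, in the ball of radius the index of `H`. -/
theorem exists_mem_ballSet_mul_inv_mem (hS : Subgroup.closure S = ⊤) (H : Subgroup G)
    [H.FiniteIndex] (g : G) : ∃ b ∈ ballSet S H.index, g * b⁻¹ ∈ H := by
  have huniv : (QuotientGroup.mk '' ballSet S H.index : Set (G ⧸ H)) = Set.univ := by
    refine (image_mk_ballSet_eq_univ_or hS H H.index).resolve_right fun h => ?_
    have := Set.ncard_le_card (QuotientGroup.mk '' ballSet S H.index : Set (G ⧸ H))
    rw [← Subgroup.index_eq_card] at this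
    omega
  obtain ⟨b, hb, hbg⟩ := huniv.ge (Set.mem_univ ((g⁻¹ : G) : G ⧸ H))
  refine ⟨b⁻¹, inv_mem_ballSet hb, ?_⟩
  have := QuotientGroup.eq.mp hbg.symm
  simpa using this

/-- A subgroup of finite index `d` is generated by its elements in the ball of radius `3 * d`. -/
theorem exists_generators_subset_ballSet (hS : Subgroup.closure S = ⊤) (hfin : S.Finite)
    (H : Subgroup G) [H.FiniteIndex] :
    ∃ T : Set H, T.Finite ∧ Subgroup.closure T = ⊤ ∧
      ∀ t ∈ T, (t : G) ∈ ballSet S (3 * H.index) := by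
  classical
  have hex : ∀ q : Quotient (QuotientGroup.rightRel H), ∃ b ∈ ballSet S H.index,
      Quotient.mk'' b = q := by
    intro q
    induction q using Quotient.inductionOn' with
    | h g =>
      obtain ⟨b, hb, hbg⟩ := exists_mem_ballSet_mul_inv_mem hS H g
      exact ⟨b, hb, Quotient.sound' (QuotientGroup.rightRel_apply.mpr hbg)⟩
  choose r hr hrq using hex
  let f := Function.update r (Quotient.mk'' 1) 1
  have hfq : ∀ q, Quotient.mk'' (f q) = q := by
    intro q
    by_cases hq : q = Quotient.mk'' 1
    · subst hq; simp [f]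
    · simp [f, hq, hrq]
  have hfb : ∀ q, f q ∈ ballSet S H.index := by
    intro q
    by_cases hq : q = Quotient.mk'' 1
    · subst hq; simpa [f] using one_mem_ballSet S H.index
    · simpa [f, hq] using hr q
  have hR := Subgroup.isComplement_range_right hfq
  have hRb : Set.range f ⊆ ballSet S H.index := Set.range_subset_iff.mpr hfb
  have hR1 : (1 : G) ∈ Set.range f := ⟨_, Function.update_self _ _ _⟩
  refine ⟨_, ?_, Subgroup.closure_mul_image_eq_top hR hR1 hS, ?_⟩
  · exact Set.Finite.image _ (((ballSet_finite hfin _).subset hRb).mul hfin)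
  · rintro _ ⟨_, ⟨x, hx, s, hs, rfl⟩, rfl⟩
    have hpos : H.index ≠ 0 := Subgroup.FiniteIndex.index_ne_zero
    exact ballSet_mono (by omega) (mul_mem_ballSet
      (mul_mem_ballSet (hRb hx) (subset_ballSet_one hs))
      (inv_mem_ballSet (hRb (hR.toRightFun (x * s)).2)))

/-- If `g` commutes with `[g, h]` then `[g ^ k, h] = [g, h] ^ k`. -/
theorem commutatorElement_pow_left (hc : Commute g ⁅g, h⁆) (k : ℕ) : ⁅g ^ k, h⁆ = ⁅g, h⁆ ^ k := by
  induction k with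
  | zero => simp
  | succ k ih =>
    have hk : g * ⁅g, h⁆ ^ k = ⁅g, h⁆ ^ k * g := hc.pow_right k
    calc ⁅g ^ (k + 1), h⁆ = g * ⁅g ^ k, h⁆ * (h * g⁻¹ * h⁻¹) := by
          rw [pow_succ']; simp only [commutatorElement_def]; group
      _ = ⁅g, h⁆ ^ k * ⁅g, h⁆ := by rw [ih, hk]; simp only [commutatorElement_def, mul_assoc]
      _ = ⁅g, h⁆ ^ (k + 1) := (pow_succ _ _).symm

/-- If `g` and `h` lie in a ball of radius `m` and `g` commutes with `[g, h]`, which has infinite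
order, then the ball of radius `n` has at least `n / m + 1` commutators. -/
theorem div_add_one_le_ncard_commPairs (hS : S.Finite) (hg : g ∈ ballSet S m)
    (hh : h ∈ ballSet S m) (hc : Commute g ⁅g, h⁆) (hinf : ¬ IsOfFinOrder ⁅g, h⁆) (n : ℕ) :
    n / m + 1 ≤ (commPairs (ballSet S n) (ballSet S n)).ncard := by
  have hinj : Function.Injective fun k : ℕ => ⁅g, h⁆ ^ k :=
    injective_pow_iff_not_isOfFinOrder.mpr hinf
  have hsub : (fun k : ℕ => ⁅g, h⁆ ^ k) '' Set.Iic (n / m) ⊆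
      commPairs (ballSet S n) (ballSet S n) := by
    rintro _ ⟨k, hk, rfl⟩
    rcases Nat.eq_zero_or_pos k with rfl | hpos
    · exact ⟨1, one_mem_ballSet S n, 1, one_mem_ballSet S n, by simp⟩
    · have hkn : m * k ≤ n := (Nat.mul_le_mul_left m hk).trans (Nat.mul_div_le n m)
      exact ⟨g ^ k, ballSet_mono hkn (pow_mem_ballSet_s18 hg k), h,
        ballSet_mono ((Nat.le_mul_of_pos_right m hpos).trans hkn) hh,
        (commutatorElement_pow_left hc k).symm⟩
  have hcard := Set.ncard_le_ncard hsub
    (commPairs_finite (ballSet_finite hS n) (ballSet_finite hS n))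
  rwa [Set.ncard_image_of_injective _ hinj, ← Finset.coe_Iic, Set.ncard_coe_finset,
    Nat.card_Iic] at hcard

end Ball

/-- Let `G` be a finitely generated group that is not virtually abelian,
with finite generating set `S`, and suppose `G` has a subgroup `H` of finite index `d`
that is nilpotent of class at most 2 (`[H,[H,H]] = 1`). Then
`|C(S^{≤n}, S^{≤n})| ≥ n/(3d)` for every `n ≥ 1`. -/
theorem statement18 {G : Type*} [Group G] (hva : ¬ VirtuallyAbelian G)
    (S : Finset G) (hgen : Subgroup.closure (S : Set G) = ⊤)
    (H : Subgroup G) (d : ℕ) (hd : 0 < d) (hidx : H.index = d)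
    (hnil : ⁅H, ⁅H, H⁆⁆ = ⊥) :
    ∀ n : ℕ, 1 ≤ n →
      (n : ℝ) / (3 * (d : ℝ)) ≤
        ((commPairs (ballSet (S : Set G) n) (ballSet (S : Set G) n)).ncard : ℝ) := by
  intro n _
  subst hidx
  have : H.FiniteIndex := ⟨hd.ne'⟩
  obtain ⟨T, hTfin, hTgen, hTball⟩ := exists_generators_subset_ballSet hgen S.finite_toSet H
  have : Group.FG H := Group.fg_iff.mpr ⟨T, hTgen, hTfin⟩
  have hclass : ∀ x y z : H, Commute x ⁅y, z⁆ := fun x y z => by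
    rw [← commutatorElement_eq_one_iff_commute]
    have hmem : ⁅(x : G), ⁅(y : G), (z : G)⁆⁆ ∈ ⁅H, ⁅H, H⁆⁆ :=
      Subgroup.commutator_mem_commutator x.2 (Subgroup.commutator_mem_commutator y.2 z.2)
    rw [hnil, Subgroup.mem_bot] at hmem
    exact Subtype.ext hmem
  obtain ⟨s, hs, t, ht, hst⟩ : ∃ s ∈ T, ∃ t ∈ T, ¬ IsOfFinOrder ⁅s, t⁆ := by
    by_contra! hfin
    exact hva (virtuallyAbelian_of_finite_commutatorSet H (finite_commutatorSet_of_isOfFinOrder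
      (fun x y => Subgroup.mem_center_iff.mpr fun z => hclass z x y) hTfin hTgen hfin))
  have hcard := div_add_one_le_ncard_commPairs S.finite_toSet (hTball s hs) (hTball t ht)
    ((hclass s s t).map H.subtype) (fun h => hst (Submonoid.isOfFinOrder_coe.mp h)) n
  have hlt : n < 3 * H.index * (n / (3 * H.index) + 1) := Nat.lt_mul_div_succ n (by omega)
  have hle := hlt.le.trans (Nat.mul_le_mul_left _ hcard)
  have hd' : (0 : ℝ) < 3 * (H.index : ℝ) := by positivity
  rw [div_le_iff₀' hd']
  exact_mod_cast hle
end
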